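/- (Theorem 1) Suppose Σ is invertible and 1 + b²p̂(1−p̂)(σ_{mm} + τ_{mm}) ≠ 0, and set C = (1 + b²p̂(1−p̂)(σ_{mm} + τ_{mm}))⁻¹. Then for every l ∈ {1,…,n}, the l-th entry of μ′ satisfies μ′_l = μ_l + b·C·σ_{lm}·(s − p̂) and the (n+l)-th entry satisfies μ′_{n+l} = μ_{n+l} + b·C·τ_{lm}·((1−s) − (1−p̂)). In particular, taking l = m, μ′_m = μ_m + b·C·σ_{mm}·(s − p̂). -/

import Mathlib

open Matrix

/-- A rank-one update of `-S⁻¹` by `d • a aᵀ`: if `1 - d (aᵀ S a) ≠ 0`, the inverse of the updated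
matrix sends `a` to the multiple `-(1 - d (aᵀ S a))⁻¹` of `S a`. -/
theorem inv_neg_inv_add_smul_vecMulVec_mulVec {ι K : Type*} [Fintype ι] [DecidableEq ι] [Field K]
    {S : Matrix ι ι K} (hS : IsUnit S.det) (a : ι → K) {d : K}
    (hd : 1 - d * (a ⬝ᵥ S *ᵥ a) ≠ 0) :
    (-S⁻¹ + d • vecMulVec a a)⁻¹ *ᵥ a = -(1 - d * (a ⬝ᵥ S *ᵥ a))⁻¹ • S *ᵥ a := by
  set H := -S⁻¹ + d • vecMulVec a a
  have mulVec_eq (v : ι → K) : H *ᵥ v = -(S⁻¹ *ᵥ v) + (d * (a ⬝ᵥ v)) • a := by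
    simp [H, add_mulVec, neg_mulVec, smul_mulVec, vecMulVec_mulVec, smul_smul]
  have isUnit_det : IsUnit H.det := by
    rw [← isUnit_iff_isUnit_det, ← mulVec_injective_iff_isUnit]
    refine (injective_iff_map_eq_zero H.mulVecLin).2 fun v hv => ?_
    rw [mulVecLin_apply, mulVec_eq, neg_add_eq_zero] at hv
    have v_eq : v = (d * (a ⬝ᵥ v)) • S *ᵥ a := by
      rw [← mulVec_smul, ← hv, mulVec_mulVec, mul_nonsing_inv S hS, one_mulVec]
    have dot_eq := congrArg (a ⬝ᵥ ·) v_eq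
    simp only [dotProduct_smul, smul_eq_mul] at dot_eq
    have dot_zero : a ⬝ᵥ v = 0 :=
      (mul_eq_zero.1 (by linear_combination dot_eq :
        (1 - d * (a ⬝ᵥ S *ᵥ a)) * (a ⬝ᵥ v) = 0)).resolve_left hd
    rw [v_eq, dot_zero, mul_zero, zero_smul]
  have mulVec_S : H *ᵥ (S *ᵥ a) = -(1 - d * (a ⬝ᵥ S *ᵥ a)) • a := by
    rw [mulVec_eq, mulVec_mulVec, nonsing_inv_mul S hS, one_mulVec]
    module
  have inv_mulVec : S *ᵥ a = -(1 - d * (a ⬝ᵥ S *ᵥ a)) • (H⁻¹ *ᵥ a) := by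
    rw [← mulVec_smul, ← mulVec_S, mulVec_mulVec, nonsing_inv_mul H isUnit_det, one_mulVec]
  generalize 1 - d * (a ⬝ᵥ S *ᵥ a) = c at hd inv_mulVec ⊢
  rw [inv_mulVec, smul_smul, neg_mul_neg, inv_mul_cancel₀ hd, one_smul]

/-- Theorem 1. With `phat = e^{bμ_m}/(e^{bμ_m}+e^{bμ_{n+m}})`, `d = -b²phat(1-phat)`,
`D = d·a·aᵀ`, `H = -S⁻¹ + D`, `J = b(s-phat)·a`, `μ' = μ - H⁻¹J`, and
`C = (1 + b²phat(1-phat)(σ_{mm}+τ_{mm}))⁻¹`: for every surface `l`,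
`μ'_l = μ_l + b·C·σ_{lm}·(s - phat)` and `μ'_{n+l} = μ_{n+l} + b·C·τ_{lm}·((1-s)-(1-phat))`;
in particular `μ'_m = μ_m + b·C·σ_{mm}·(s - phat)`. -/
theorem stmt_5 (n : ℕ) (hn : 1 ≤ n) (m : Fin n) (b : ℝ) (hb : 0 < b)
    (s : ℝ) (hs : s = 0 ∨ s = 1)
    (Λ T : Matrix (Fin n) (Fin n) ℝ)
    (a : Fin n ⊕ Fin n → ℝ)
    (ha : a = Sum.elim (fun k => if k = m then (1 : ℝ) else 0)
      (fun k => if k = m then (-1 : ℝ) else 0))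
    (S : Matrix (Fin n ⊕ Fin n) (Fin n ⊕ Fin n) ℝ)
    (hS : S = Matrix.fromBlocks Λ 0 0 T)
    (hSinv : IsUnit S.det)
    (μ : Fin n ⊕ Fin n → ℝ)
    (phat : ℝ)
    (hphat : phat = Real.exp (b * μ (Sum.inl m)) /
      (Real.exp (b * μ (Sum.inl m)) + Real.exp (b * μ (Sum.inr m))))
    (d : ℝ) (hd : d = -(b ^ 2 * phat * (1 - phat)))
    (D : Matrix (Fin n ⊕ Fin n) (Fin n ⊕ Fin n) ℝ)
    (hD : D = d • Matrix.vecMulVec a a)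
    (H : Matrix (Fin n ⊕ Fin n) (Fin n ⊕ Fin n) ℝ)
    (hH : H = -S⁻¹ + D)
    (hdet : 1 + b ^ 2 * phat * (1 - phat) * (Λ m m + T m m) ≠ 0)
    (C : ℝ) (hC : C = (1 + b ^ 2 * phat * (1 - phat) * (Λ m m + T m m))⁻¹)
    (J : Fin n ⊕ Fin n → ℝ) (hJ : J = (b * (s - phat)) • a)
    (μ' : Fin n ⊕ Fin n → ℝ) (hμ' : μ' = μ - H⁻¹ *ᵥ J) :
    (∀ l : Fin n,
      μ' (Sum.inl l) = μ (Sum.inl l) + b * C * Λ l m * (s - phat) ∧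
      μ' (Sum.inr l) = μ (Sum.inr l) + b * C * T l m * ((1 - s) - (1 - phat))) ∧
    μ' (Sum.inl m) = μ (Sum.inl m) + b * C * Λ m m * (s - phat) := by
  have mulVec_inl (l : Fin n) : (S *ᵥ a) (Sum.inl l) = Λ l m := by
    simp [hS, ha, mulVec, dotProduct]
  have mulVec_inr (l : Fin n) : (S *ᵥ a) (Sum.inr l) = -T l m := by
    simp [hS, ha, mulVec, dotProduct]
  have dot_eq : a ⬝ᵥ S *ᵥ a = Λ m m + T m m := by
    simp only [dotProduct, Fintype.sum_sum_type, mulVec_inl, mulVec_inr]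
    simp [ha]
  have det_eq : 1 - d * (a ⬝ᵥ S *ᵥ a) =
      1 + b ^ 2 * phat * (1 - phat) * (Λ m m + T m m) := by
    rw [dot_eq, hd]
    ring
  have update_eq (i : Fin n ⊕ Fin n) : μ' i = μ i + b * C * (S *ᵥ a) i * (s - phat) := by
    rw [hμ', hJ, mulVec_smul, hH, hD,
      inv_neg_inv_add_smul_vecMulVec_mulVec hSinv a (det_eq ▸ hdet), det_eq, ← hC]
    simp only [Pi.sub_apply, Pi.smul_apply, smul_eq_mul]
    ring
  have update_inl (l : Fin n) :
      μ' (Sum.inl l) = μ (Sum.inl l) + b * C * Λ l m * (s - phat) := by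
    rw [update_eq, mulVec_inl]
  refine ⟨fun l => ⟨update_inl l, ?_⟩, update_inl m⟩
  rw [update_eq, mulVec_inr]
  ring
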